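/- Let X be a Polish space and let f : X → ω^ω be a function of Baire class 1 (the preimage under f of every open set is Fσ). For every closed set K ⊆ X the following are equivalent: (a) K ∉ I^f; (b) there exist an open set U ⊆ ω^ω and a topological embedding c : 2^ω → X with c[2^ω] ⊆ K such that both c[2^ω] ∩ f⁻¹[U] and c[2^ω] \ f⁻¹[U] are dense in c[2^ω]. -/

import Mathlib

open Set

/-- `f` is of Baire class 1: the preimage of every open set is `Fσ`. -/
def BaireClassOne {X : Type*} [TopologicalSpace X] (f : X → (ℕ → ℕ)) : Prop :=
  ∀ U : Set (ℕ → ℕ), IsOpen U →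
    ∃ F : ℕ → Set X, (∀ n, IsClosed (F n)) ∧ f ⁻¹' U = ⋃ n, F n

/-- The σ-ideal `I^f` generated by the closed sets on which `f` is continuous:
`A ∈ I^f` iff `A` is covered by countably many closed sets on which `f` restricts
to a continuous function. -/
def contIdeal {X : Type*} [TopologicalSpace X] (f : X → (ℕ → ℕ)) : Set (Set X) :=
  {A | ∃ C : ℕ → Set X, (∀ n, IsClosed (C n) ∧ ContinuousOn f (C n)) ∧ A ⊆ ⋃ n, C n}

open Filter Topology

section ContIdeal

variable {X : Type*} [TopologicalSpace X] {f : X → (ℕ → ℕ)}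

theorem mem_contIdeal_iff_countable {A : Set X} :
    A ∈ contIdeal f ↔ ∃ 𝒞 : Set (Set X), 𝒞.Countable ∧
      (∀ C ∈ 𝒞, IsClosed C ∧ ContinuousOn f C) ∧ A ⊆ ⋃₀ 𝒞 := by
  constructor
  · rintro ⟨C, hC, hA⟩
    refine ⟨range C, countable_range C, ?_, by simpa using hA⟩
    rintro _ ⟨n, rfl⟩
    exact hC n
  · rintro ⟨𝒞, hcount, h𝒞, hA⟩
    obtain ⟨C, hC⟩ := (hcount.insert ∅).exists_eq_range (insert_nonempty _ _)
    refine ⟨C, fun n => ?_, ?_⟩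
    · have hn : C n ∈ insert ∅ 𝒞 := hC ▸ mem_range_self n
      rcases hn with hn | hn
      · rw [hn]
        exact ⟨isClosed_empty, continuousOn_empty f⟩
      · exact h𝒞 _ hn
    · rw [← sUnion_range, ← hC]
      exact hA.trans (sUnion_subset_sUnion (subset_insert _ _))

theorem contIdeal_mono {A B : Set X} (hAB : A ⊆ B) (hB : B ∈ contIdeal f) :
    A ∈ contIdeal f := by
  obtain ⟨C, hC, hBC⟩ := hB
  exact ⟨C, hC, hAB.trans hBC⟩

theorem contIdeal_sUnion {S : Set (Set X)} (hS : S.Countable)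
    (h : ∀ A ∈ S, A ∈ contIdeal f) : ⋃₀ S ∈ contIdeal f := by
  choose! 𝒞 hcount h𝒞 hA using fun A hA => mem_contIdeal_iff_countable.1 (h A hA)
  refine mem_contIdeal_iff_countable.2 ⟨⋃ A ∈ S, 𝒞 A, hS.biUnion hcount, ?_, ?_⟩
  · intro C hC
    obtain ⟨A, hAS, hCA⟩ := mem_iUnion₂.1 hC
    exact h𝒞 A hAS C hCA
  · refine sUnion_subset fun A hAS => (hA A hAS).trans (sUnion_subset_sUnion ?_)
    exact subset_biUnion_of_mem (u := 𝒞) hAS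

theorem contIdeal_union {A B : Set X} (hA : A ∈ contIdeal f) (hB : B ∈ contIdeal f) :
    A ∪ B ∈ contIdeal f := by
  rw [← sUnion_pair]
  exact contIdeal_sUnion (to_countable _) (by simp [hA, hB])

theorem contIdeal_of_continuousOn {A : Set X} (hA : IsClosed A) (hf : ContinuousOn f A) :
    A ∈ contIdeal f :=
  ⟨fun _ => A, fun _ => ⟨hA, hf⟩, subset_iUnion (fun _ : ℕ => A) 0⟩

/-- A set that belongs to `I^f` locally belongs to `I^f`. -/
theorem contIdeal_of_locally [SecondCountableTopology X] {A : Set X}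
    (h : ∀ x ∈ A, ∃ V ∈ 𝓝 x, V ∩ A ∈ contIdeal f) : A ∈ contIdeal f := by
  refine (HereditarilyLindelofSpace.isLindelof A).induction_on (p := (· ∈ contIdeal f))
    (fun _ _ => contIdeal_mono) (fun _ => contIdeal_sUnion) fun x hx => ?_
  obtain ⟨V, hV, hVA⟩ := h x hx
  exact ⟨V ∩ A, inter_mem (mem_nhdsWithin_of_mem_nhds hV) self_mem_nhdsWithin, hVA⟩

/-- A set is `Fσ` if it is a countable union of closed sets. -/
def IsFSigma (A : Set X) : Prop :=
  ∃ F : ℕ → Set X, (∀ n, IsClosed (F n)) ∧ A = ⋃ n, F n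

theorem isFSigma_of_isClosed {A : Set X} (hA : IsClosed A) : IsFSigma A :=
  ⟨fun _ => A, fun _ => hA, (iUnion_const A).symm⟩

theorem IsFSigma.inter {A B : Set X} (hA : IsFSigma A) (hB : IsFSigma B) :
    IsFSigma (A ∩ B) := by
  obtain ⟨F, hF, rfl⟩ := hA
  obtain ⟨G, hG, rfl⟩ := hB
  refine ⟨fun n => F n.unpair.1 ∩ G n.unpair.2, fun n => (hF _).inter (hG _), ?_⟩
  rw [iUnion_inter_iUnion]
  rw [Nat.surjective_unpair.iUnion_comp fun p : ℕ × ℕ => F p.1 ∩ G p.2, iUnion_prod']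

theorem isFSigma_of_isOpen [TopologicalSpace.MetrizableSpace X] {A : Set X} (hA : IsOpen A) :
    IsFSigma A := by
  let := TopologicalSpace.metrizableSpaceMetric X
  obtain ⟨F, hF, -, hFA, -⟩ := hA.exists_iUnion_isClosed
  exact ⟨F, hF, hFA.symm⟩

theorem IsFSigma.exists_isClosed_subset {A : Set X} (hA : IsFSigma A) (h : A ∉ contIdeal f) :
    ∃ F ⊆ A, IsClosed F ∧ F ∉ contIdeal f := by
  obtain ⟨F, hF, rfl⟩ := hA
  by_contra! hc
  refine h ?_
  rw [← sUnion_range]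
  refine contIdeal_sUnion (countable_range F) ?_
  rintro _ ⟨n, rfl⟩
  exact hc _ (subset_iUnion F n) (hF n)

end ContIdeal

theorem PiNat.isClosed_cylinder (y : ℕ → ℕ) (m : ℕ) : IsClosed (PiNat.cylinder y m) := by
  rw [PiNat.cylinder_eq_pi]
  exact isClosed_set_pi fun _ _ => isClosed_discrete _

theorem PiNat.exists_disjoint_cylinders {y z : ℕ → ℕ} (h : y ≠ z) :
    ∃ m, Disjoint (PiNat.cylinder y m) (PiNat.cylinder z m) := by
  obtain ⟨i, hi⟩ := Function.ne_iff.1 h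
  refine ⟨i + 1, Set.disjoint_left.2 fun w hy hz => hi ?_⟩
  rw [← hy i i.lt_succ_self, hz i i.lt_succ_self]

section Irreducible

variable {X : Type*} [TopologicalSpace X] {f : X → (ℕ → ℕ)}

/-- Every neighbourhood of `x` meets `B` in a set outside `I^f`. -/
def LocallyPositive (f : X → (ℕ → ℕ)) (B : Set X) (x : X) : Prop :=
  ∀ V ∈ 𝓝 x, V ∩ B ∉ contIdeal f

theorem LocallyPositive.mono {A B : Set X} {x : X} (hAB : A ⊆ B)
    (h : LocallyPositive f A x) : LocallyPositive f B x :=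
  fun V hV hB => h V hV (contIdeal_mono (inter_subset_inter_right V hAB) hB)

theorem not_locallyPositive_union {A B : Set X} {x : X} (hA : ¬ LocallyPositive f A x)
    (hB : ¬ LocallyPositive f B x) : ¬ LocallyPositive f (A ∪ B) x := by
  simp only [LocallyPositive, not_forall, not_not] at *
  obtain ⟨V, hV, hVA⟩ := hA
  obtain ⟨W, hW, hWB⟩ := hB
  refine ⟨V ∩ W, inter_mem hV hW, contIdeal_mono ?_ (contIdeal_union hVA hWB)⟩
  rintro y ⟨⟨hyV, hyW⟩, hyA | hyB⟩
  exacts [Or.inl ⟨hyV, hyA⟩, Or.inr ⟨hyW, hyB⟩]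

theorem diff_subset_union_diff_cylinder {X : Type*} {f : X → (ℕ → ℕ)} (B : Set X)
    {y z : ℕ → ℕ} {m : ℕ}
    (h : Disjoint (PiNat.cylinder y m) (PiNat.cylinder z m)) :
    B ⊆ B \ f ⁻¹' PiNat.cylinder y m ∪ B \ f ⁻¹' PiNat.cylinder z m := by
  intro x hx
  by_cases hy : f x ∈ PiNat.cylinder y m
  · exact Or.inr ⟨hx, Set.disjoint_left.1 h hy⟩
  · exact Or.inl ⟨hx, hy⟩

/-- If a set is positive near `x`, all but at most one value can be removed together with some
neighbourhood of that value so that the rest is still positive near `x`. -/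
theorem LocallyPositive.subsingleton_exceptional {B : Set X} {x : X}
    (h : LocallyPositive f B x) :
    {y | ∀ m, ¬ LocallyPositive f (B \ f ⁻¹' PiNat.cylinder y m) x}.Subsingleton := by
  intro y hy z hz
  by_contra hne
  obtain ⟨m, hm⟩ := PiNat.exists_disjoint_cylinders hne
  exact not_locallyPositive_union (hy m) (hz m)
    (h.mono (diff_subset_union_diff_cylinder B hm))

variable [SecondCountableTopology X]

theorem exists_locallyPositive_diff_cylinder {F : Set X} (hF : IsClosed F)
    (h : F ∉ contIdeal f) :
    ∃ x ∈ F, ∃ m, LocallyPositive f (F \ f ⁻¹' PiNat.cylinder (f x) m) x := by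
  by_contra! hc
  set P := {x ∈ F | LocallyPositive f F x} with hP
  have hopen : IsOpen {x | ¬ LocallyPositive f F x} := by
    rw [isOpen_iff_mem_nhds]
    intro x hx
    simp only [LocallyPositive, not_forall, not_not, mem_ofPred_eq] at hx ⊢
    obtain ⟨V, hV, hVF⟩ := hx
    filter_upwards [eventually_mem_nhds_iff.2 hV] with y hy using ⟨V, hy, hVF⟩
  have hPclosed : IsClosed P := by
    convert hF.inter hopen.isClosed_compl using 1
    ext x
    simp [hP]
  have hdiff : F \ P ∈ contIdeal f := by
    refine contIdeal_of_locally fun x hx => ?_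
    have hx' : ¬ LocallyPositive f F x := fun hx' => hx.2 ⟨hx.1, hx'⟩
    simp only [LocallyPositive, not_forall, not_not] at hx'
    obtain ⟨V, hV, hVF⟩ := hx'
    exact ⟨V, hV, contIdeal_mono (inter_subset_inter_right V sdiff_subset) hVF⟩
  have hcont : ContinuousOn f P := by
    intro x hx
    rw [ContinuousWithinAt, tendsto_pi_nhds]
    intro i
    rw [nhds_discrete, tendsto_pure]
    have hxm := hc x hx.1 (i + 1)
    simp only [LocallyPositive, not_forall, not_not] at hxm
    obtain ⟨V, hV, hVF⟩ := hxm
    filter_upwards [mem_nhdsWithin_of_mem_nhds (eventually_mem_nhds_iff.2 hV),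
      self_mem_nhdsWithin] with y hyV hyP
    by_contra hne
    have hdisj : Disjoint (PiNat.cylinder (f x) (i + 1)) (PiNat.cylinder (f y) (i + 1)) :=
      Set.disjoint_left.2 fun w hw hw' => hne <| by
        rw [← hw i i.lt_succ_self, hw' i i.lt_succ_self]
    refine not_locallyPositive_union (fun hpos => hpos V hyV hVF) (hc y hyP.1 (i + 1))
      (hyP.2.mono (diff_subset_union_diff_cylinder F hdisj))
  refine h (contIdeal_mono (fun x hx => ?_)
    (contIdeal_union (contIdeal_of_continuousOn hPclosed hcont) hdiff))
  by_cases hxP : x ∈ P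
  exacts [Or.inl hxP, Or.inr ⟨hx, hxP⟩]

theorem exists_locallyPositive_diff_cylinder_of_finite (hf : BaireClassOne f)
    {Y : Set (ℕ → ℕ)} (hY : Y.Finite) {F : Set X} (hF : IsClosed F) (h : F ∉ contIdeal f) :
    ∃ x ∈ F, f x ∉ Y ∧ ∃ m, LocallyPositive f (F \ f ⁻¹' PiNat.cylinder (f x) m) x := by
  induction Y, hY using Set.Finite.induction_on generalizing F with
  | empty => simpa using exists_locallyPositive_diff_cylinder hF h
  | @insert y Y _ _ ih =>
    obtain ⟨x, hxF, hxY, m, hx⟩ := ih hF h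
    by_cases hxy : f x = y
    · have hpos : F \ f ⁻¹' PiNat.cylinder (f x) m ∉ contIdeal f := by
        simpa using hx univ univ_mem
      have hσ : IsFSigma (F \ f ⁻¹' PiNat.cylinder (f x) m) :=
        (isFSigma_of_isClosed hF).inter (hf _ (PiNat.isClosed_cylinder (f x) m).isOpen_compl)
      obtain ⟨G, hGF, hG, hGpos⟩ := hσ.exists_isClosed_subset hpos
      obtain ⟨z, hzG, hzY, k, hz⟩ := ih hG hGpos
      refine ⟨z, (hGF hzG).1, ?_, k, hz.mono (sdiff_subset_sdiff_left (hGF.trans sdiff_subset))⟩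
      rintro (hzy | hzY')
      · refine (hGF hzG).2 ?_
        rw [mem_preimage, hzy, ← hxy]
        exact PiNat.self_mem_cylinder _ _
      · exact hzY hzY'
    · exact ⟨x, hxF, fun hx' => hx'.elim hxy hxY, m, hx⟩

/-- Given finitely many points near which `K \ f ⁻¹' A` is positive, one can add a new point
of any positive closed subset of `K \ f ⁻¹' A` and enlarge the clopen set `A` to contain its
value, keeping positivity near all the points. -/
theorem exists_locallyPositive_extension (hf : BaireClassOne f) {K : Set X}
    {S : Set X} (hS : S.Finite) {A : Set (ℕ → ℕ)} (hA : IsClopen A)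
    (hpos : ∀ x ∈ S, LocallyPositive f (K \ f ⁻¹' A) x)
    {F : Set X} (hF : IsClosed F) (hFK : F ⊆ K \ f ⁻¹' A) (hFpos : F ∉ contIdeal f) :
    ∃ x ∈ F, ∃ B, IsClopen B ∧ A ⊆ B ∧ f x ∈ B ∧
      ∀ z ∈ insert x S, LocallyPositive f (K \ f ⁻¹' B) z := by
  obtain ⟨x, hxF, hxY, m, hx⟩ := exists_locallyPositive_diff_cylinder_of_finite hf
    (hS.biUnion fun z hz => (hpos z hz).subsingleton_exceptional.finite) hF hFpos
  simp only [mem_iUnion, mem_ofPred_eq, not_exists, not_forall, not_not] at hxY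
  choose! k hk using hxY
  obtain ⟨n, hn⟩ := (hS.image k).bddAbove
  have hanti {G : Set X} {i : ℕ} (hi : i ≤ max m n) : G \ f ⁻¹' PiNat.cylinder (f x) i ⊆
      G \ f ⁻¹' PiNat.cylinder (f x) (max m n) :=
    sdiff_subset_sdiff_right (preimage_mono (PiNat.cylinder_anti _ hi))
  refine ⟨x, hxF, A ∪ PiNat.cylinder (f x) (max m n),
    hA.union ⟨PiNat.isClosed_cylinder _ _, PiNat.isOpen_cylinder _ _ _⟩, subset_union_left,
    Or.inr (PiNat.self_mem_cylinder _ _), ?_⟩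
  rw [preimage_union, ← Set.sdiff_sdiff]
  rintro z (rfl | hz)
  · exact hx.mono ((hanti (le_max_left _ _)).trans (sdiff_subset_sdiff_left hFK))
  · exact (hk z hz).mono (hanti ((hn (mem_image_of_mem k hz)).trans (le_max_right _ _)))

end Irreducible

section Metric

variable {X : Type*} [MetricSpace X]

theorem exists_seq_avoiding [SecondCountableTopology X] {f : X → (ℕ → ℕ)}
    (hf : BaireClassOne f) {K : Set X} (hK : IsClosed K) (hpos : K ∉ contIdeal f) :
    ∃ (x : ℕ → X) (A : ℕ → Set (ℕ → ℕ)), (∀ n, x n ∈ K) ∧ (∀ n, IsClopen (A n)) ∧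
      (∀ n, f (x n) ∈ A n) ∧ (∀ m n, m < n → f (x n) ∉ A m) ∧
      ∀ n : ℕ, dist (x (n + 1)) (x n.unpair.1) < 1 / (n + 1) := by
  let Inv (n : ℕ) (s : (ℕ → X) × Set (ℕ → ℕ)) : Prop := IsClopen s.2 ∧
    ∀ i ≤ n, s.1 i ∈ K ∧ f (s.1 i) ∈ s.2 ∧ LocallyPositive f (K \ f ⁻¹' s.2) (s.1 i)
  obtain ⟨s₀, hs₀⟩ : ∃ s, Inv 0 s := by
    obtain ⟨x, hx, B, hB, -, hxB, hxpos⟩ := exists_locallyPositive_extension hf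
      (K := K) finite_empty isClopen_empty (by simp) hK (by simp) hpos
    refine ⟨(fun _ => x, B), hB, fun i _ => ⟨hx, hxB, hxpos x (mem_insert _ _)⟩⟩
  have step (n : ℕ) (s : {s // Inv n s}) : ∃ t : {t // Inv (n + 1) t},
      s.1.2 ⊆ t.1.2 ∧ (∀ i ≤ n, t.1.1 i = s.1.1 i) ∧ f (t.1.1 (n + 1)) ∉ s.1.2 ∧
      dist (t.1.1 (n + 1)) (s.1.1 n.unpair.1) < 1 / (n + 1) := by
    obtain ⟨⟨p, A⟩, hA, hp⟩ := s
    dsimp only at hA hp ⊢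
    have hball := (hp _ n.unpair_left_le).2.2 _
      (Metric.ball_mem_nhds _ (Nat.one_div_pos_of_nat (α := ℝ) (n := n)))
    have hσ := (isFSigma_of_isOpen (Metric.isOpen_ball (x := p n.unpair.1)
      (ε := 1 / ((n : ℝ) + 1)))).inter
      ((isFSigma_of_isClosed hK).inter (hf Aᶜ hA.compl.isOpen))
    obtain ⟨F, hFsub, hF, hFpos⟩ := hσ.exists_isClosed_subset hball
    obtain ⟨x, hx, B, hB, hAB, hxB, hxpos⟩ := exists_locallyPositive_extension hf
      ((finite_Iic n).image p) hA (by rintro _ ⟨i, hi, rfl⟩; exact (hp i hi).2.2) hF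
      (hFsub.trans inter_subset_right) hFpos
    have hlt {i : ℕ} (hi : i ≤ n) : Function.update p (n + 1) x i = p i :=
      Function.update_of_ne (by omega) _ _
    refine ⟨⟨(Function.update p (n + 1) x, B), hB, fun i hi => ?_⟩, hAB, fun i => hlt, ?_, ?_⟩
    · rcases Nat.le_succ_iff.1 hi with hi | rfl
      · dsimp only
        rw [hlt hi]
        exact ⟨(hp i hi).1, hAB (hp i hi).2.1, hxpos _ (Or.inr (mem_image_of_mem p hi))⟩
      · simpa using ⟨(hFsub hx).2.1, hxB, hxpos x (mem_insert _ _)⟩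
    · simpa using (hFsub hx).2.2
    · simpa using (hFsub hx).1
  choose next hnext using step
  let s (n : ℕ) : {s // Inv n s} := Nat.rec ⟨s₀, hs₀⟩ next n
  have hs (n : ℕ) : s (n + 1) = next n (s n) := rfl
  have hmono : Monotone fun n => (s n).1.2 :=
    monotone_nat_of_le_succ fun n => by simpa only [hs] using (hnext n (s n)).1
  have hstable {i n : ℕ} (hi : i ≤ n) : (s n).1.1 i = (s i).1.1 i := by
    induction n, hi using Nat.le_induction with
    | base => rfl
    | succ n hin ih => rw [hs, (hnext n (s n)).2.1 i hin, ih]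
  refine ⟨fun n => (s n).1.1 n, fun n => (s n).1.2, fun n => ((s n).2.2 n le_rfl).1,
    fun n => (s n).2.1, fun n => ((s n).2.2 n le_rfl).2.1, fun m n hmn => ?_, fun n => ?_⟩
  · obtain ⟨n, rfl⟩ := Nat.exists_eq_succ_of_ne_zero (Nat.ne_zero_of_lt hmn)
    exact fun h => (hnext n (s n)).2.2.1 (hmono (Nat.lt_succ_iff.1 hmn) h)
  · dsimp only
    rw [← hstable n.unpair_left_le]
    exact (hnext n (s n)).2.2.2

theorem exists_gt_dist_lt_of_unpair {x : ℕ → X}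
    (hx : ∀ n : ℕ, dist (x (n + 1)) (x n.unpair.1) < 1 / (n + 1)) (i m : ℕ) {ε : ℝ}
    (hε : 0 < ε) : ∃ n > m, dist (x n) (x i) < ε := by
  obtain ⟨k, hk⟩ := exists_nat_one_div_lt hε
  have hle : max k m ≤ Nat.pair i (max k m) := Nat.right_le_pair _ _
  refine ⟨Nat.pair i (max k m) + 1, by omega, ?_⟩
  have := hx (Nat.pair i (max k m))
  rw [Nat.unpair_pair] at this
  refine this.trans (lt_of_le_of_lt (Nat.one_div_le_one_div (by omega)) hk)

theorem exists_isOpen_dense_codense_preimage [CompleteSpace X] [SecondCountableTopology X]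
    {f : X → (ℕ → ℕ)} (hf : BaireClassOne f) {K : Set X} (hK : IsClosed K)
    (hpos : K ∉ contIdeal f) :
    ∃ (U : Set (ℕ → ℕ)) (D : Set X), IsOpen U ∧ D.Nonempty ∧ D ⊆ K ∧
      D ⊆ closure (D ∩ f ⁻¹' U) ∧ D ⊆ closure (D \ f ⁻¹' U) := by
  obtain ⟨x, A, hxK, hA, hxA, hxA', hdist⟩ := exists_seq_avoiding hf hK hpos
  have hxD (n : ℕ) : x n ∈ closure (range x) := subset_closure (mem_range_self n)
  refine ⟨⋃ n, A n, closure (range x), isOpen_iUnion fun n => (hA n).isOpen,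
    ⟨x 0, hxD 0⟩, closure_minimal (range_subset_iff.2 hxK) hK, closure_mono ?_, ?_⟩
  · rintro _ ⟨n, rfl⟩
    exact ⟨hxD n, mem_iUnion_of_mem n (hxA n)⟩
  choose F hF hAF using fun n => hf (A n) (hA n).isOpen
  have : CompleteSpace (closure (range x)) := isClosed_closure.completeSpace_coe
  have hdense : Dense (⋂ q : ℕ × ℕ, {d : closure (range x) | (d : X) ∉ F q.1 q.2}) := by
    refine dense_iInter_of_isOpen
      (fun q => ((hF q.1 q.2).preimage continuous_subtype_val).isOpen_compl) ?_
    rintro ⟨m, k⟩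
    refine fun d => Metric.mem_closure_iff.2 fun ε hε => ?_
    obtain ⟨_, ⟨i, rfl⟩, hi⟩ := Metric.mem_closure_iff.1 d.2 (ε / 2) (half_pos hε)
    obtain ⟨n, hn, hni⟩ := exists_gt_dist_lt_of_unpair hdist i m (half_pos hε)
    refine ⟨⟨x n, hxD n⟩, fun hxF => hxA' m n hn ?_, ?_⟩
    · rw [← mem_preimage, hAF]
      exact mem_iUnion_of_mem k hxF
    · rw [Subtype.dist_eq]
      linarith [dist_triangle_right (d : X) (x n) (x i)]
  intro d hd
  refine Metric.mem_closure_iff.2 fun ε hε => ?_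
  obtain ⟨e, he, hde⟩ := Metric.mem_closure_iff.1 (hdense ⟨d, hd⟩) ε hε
  refine ⟨e, ⟨e.2, fun hU => ?_⟩, hde⟩
  obtain ⟨m, hm⟩ := mem_iUnion.1 hU
  have hm' : (e : X) ∈ f ⁻¹' A m := hm
  rw [hAF] at hm'
  obtain ⟨k, hk⟩ := mem_iUnion.1 hm'
  exact mem_iInter.1 he (m, k) hk

open CantorScheme in
/-- If a set `D` of points has both `A ∩ D` and `D \ A` dense in it, there is a Cantor set in the
closure of `D` in which `A` is dense and codense. -/
theorem exists_embedding_cantor_dense_codense [CompleteSpace X] {A D : Set X}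
    (hD : D.Nonempty) (hA : D ⊆ closure (D ∩ A)) (hA' : D ⊆ closure (D \ A)) :
    ∃ c : (ℕ → Bool) → X, Topology.IsEmbedding c ∧ range c ⊆ closure D ∧
      range c ⊆ closure (range c ∩ A) ∧ range c ⊆ closure (range c \ A) := by
  have split (p : {p : X × ℝ // p.1 ∈ D ∧ 0 < p.2}) : ∃ y ∈ D, ¬(y ∈ A ↔ p.1.1 ∈ A) ∧
      dist p.1.1 y < p.1.2 / 2 := by
    obtain ⟨⟨x, r⟩, hx, hr⟩ := p
    by_cases hxA : x ∈ A
    · obtain ⟨y, hy, hxy⟩ := Metric.mem_closure_iff.1 (hA' hx) (r / 2) (half_pos hr)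
      exact ⟨y, hy.1, fun h => hy.2 (h.2 hxA), hxy⟩
    · obtain ⟨y, hy, hxy⟩ := Metric.mem_closure_iff.1 (hA hx) (r / 2) (half_pos hr)
      exact ⟨y, hy.1, fun h => hxA (h.1 hy.2), hxy⟩
  choose y hyD hyA hy using split
  have hne (p : {p : X × ℝ // p.1 ∈ D ∧ 0 < p.2}) : 0 < dist p.1.1 (y p) :=
    dist_pos.2 fun h => hyA p (by rw [h])
  let child (b : Bool) (p : {p : X × ℝ // p.1 ∈ D ∧ 0 < p.2}) :
      {p : X × ℝ // p.1 ∈ D ∧ 0 < p.2} :=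
    ⟨(if b then y p else p.1.1, min (p.1.2 / 2) (dist p.1.1 (y p) / 3)), by
      constructor
      · cases b
        exacts [p.2.1, hyD p]
      · exact lt_min (half_pos p.2.2) (div_pos (hne p) (by norm_num))⟩
  obtain ⟨x₀, hx₀⟩ := hD
  let node (l : List Bool) : {p : X × ℝ // p.1 ∈ D ∧ 0 < p.2} :=
    l.foldr child ⟨(x₀, 1), hx₀, one_pos⟩
  have hnode (b : Bool) (l : List Bool) : node (b :: l) = child b (node l) := rfl
  let S (l : List Bool) : Set X := Metric.closedBall (node l).1.1 (node l).1.2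
  have hcenter (l : List Bool) : (node l).1.1 ∈ S l :=
    Metric.mem_closedBall_self (node l).2.2.le
  have hrad (l : List Bool) : (node l).1.2 ≤ (1 / 2) ^ l.length := by
    induction l with
    | nil => exact le_rfl
    | cons b l ih =>
      rw [hnode, List.length_cons, pow_succ]
      refine (min_le_left _ _).trans ?_
      linarith
  have hanti : ClosureAntitone S := by
    refine Antitone.closureAntitone (fun l b => ?_) fun l => Metric.isClosed_closedBall
    refine Metric.closedBall_subset_closedBall' ?_
    rw [hnode]
    have h1 := min_le_left ((node l).1.2 / 2) (dist (node l).1.1 (y (node l)) / 3)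
    have h2 := hy (node l)
    have h3 := (node l).2.2
    rw [dist_comm] at h2
    cases b <;> simp only [child, if_true, Bool.false_eq_true, if_false, dist_self] <;> linarith
  have hdiam : VanishingDiam S := by
    intro z
    have hpow : Tendsto (fun n : ℕ => ENNReal.ofReal (2 * (1 / 2 : ℝ) ^ n)) atTop (𝓝 0) := by
      have := (tendsto_pow_atTop_nhds_zero_of_lt_one (r := (1 / 2 : ℝ)) (by norm_num)
        (by norm_num)).const_mul 2
      simpa using ENNReal.tendsto_ofReal this
    refine tendsto_of_tendsto_of_tendsto_of_le_of_le tendsto_const_nhds hpow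
      (fun _ => zero_le) fun n => ?_
    refine Metric.ediam_le fun u hu v hv => ?_
    rw [edist_dist]
    refine ENNReal.ofReal_le_ofReal ?_
    have h1 := hrad (PiNat.res z n)
    rw [PiNat.res_length] at h1
    have h2 := dist_triangle_right u v (node (PiNat.res z n)).1.1
    have h3 := Metric.mem_closedBall.1 hu
    have h4 := Metric.mem_closedBall.1 hv
    linarith
  have hdisj : CantorScheme.Disjoint S := by
    have h (l : List Bool) : _root_.Disjoint (S (false :: l)) (S (true :: l)) := by
      refine Metric.closedBall_disjoint_closedBall ?_
      rw [hnode, hnode]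
      have := min_le_right ((node l).1.2 / 2) (dist (node l).1.1 (y (node l)) / 3)
      have := hne (node l)
      simp only [child, if_true, Bool.false_eq_true, if_false]
      linarith
    rintro l (_ | _) (_ | _) hab
    exacts [absurd rfl hab, h l, (h l).symm, absurd rfl hab]
  have hdom (z : ℕ → Bool) : z ∈ (inducedMap S).1 := by
    rw [hanti.map_of_vanishingDiam hdiam fun l => ⟨_, hcenter l⟩]
    exact mem_univ z
  let c (z : ℕ → Bool) : X := (inducedMap S).2 ⟨z, hdom z⟩
  have hcS (z : ℕ → Bool) (n : ℕ) : c z ∈ S (PiNat.res z n) := map_mem ⟨z, hdom z⟩ n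
  have hcont : Continuous c := hdiam.map_continuous.comp (by fun_prop)
  have hinj : Function.Injective c := fun z w h =>
    congrArg Subtype.val (hdisj.map_injective h)
  have hcenter_mem (z : ℕ → Bool) (n : ℕ) : (node (PiNat.res z n)).1.1 ∈ range c := by
    let w (k : ℕ) : Bool := if k < n then z k else false
    have hw (k : ℕ) : (node (PiNat.res w (n + k))).1.1 = (node (PiNat.res z n)).1.1 := by
      induction k with
      | zero =>
        have : PiNat.res w n = PiNat.res z n := PiNat.res_eq_res.2 fun k hk => if_pos hk
        rw [add_zero, this]
      | succ k ih =>
        rw [← ih, ← add_assoc, PiNat.res_succ, hnode]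
        simp [child, w]
    refine ⟨w, dist_le_zero.1 (le_of_forall_pos_lt_add fun ε hε => ?_)⟩
    obtain ⟨m, hm⟩ := hdiam.dist_lt ε hε w
    rw [zero_add, ← hw m]
    have hS : Antitone fun k => S (PiNat.res w k) :=
      antitone_nat_of_succ_le fun k => hanti.antitone _ _
    exact hm _ (hcS w m) _ (hS (Nat.le_add_left m n) (hcenter _))
  have hnear (z : ℕ → Bool) {ε : ℝ} (hε : 0 < ε) : ∃ n, ∀ u ∈ S (PiNat.res z n),
      dist (c z) u < ε := by
    obtain ⟨n, hn⟩ := hdiam.dist_lt ε hε z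
    exact ⟨n, fun u hu => hn _ (hcS z n) u hu⟩
  have hboth (z : ℕ → Bool) (n : ℕ) : ∃ u ∈ range c ∩ S (PiNat.res z n),
      ∃ v ∈ range c ∩ S (PiNat.res z n), ¬(v ∈ A ↔ u ∈ A) := by
    refine ⟨_, ⟨hcenter_mem z n, hcenter _⟩, y (node (PiNat.res z n)), ⟨?_, ?_⟩, hyA _⟩
    · have h := hcenter_mem (Function.update z n true) (n + 1)
      have hres : PiNat.res (Function.update z n true) n = PiNat.res z n :=
        PiNat.res_eq_res.2 fun k hk => Function.update_of_ne hk.ne _ _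
      rw [PiNat.res_succ, hnode, hres] at h
      simpa [child] using h
    · rw [Metric.mem_closedBall, dist_comm]
      linarith [hy (node (PiNat.res z n)), (node (PiNat.res z n)).2.2]
  refine ⟨c, (hcont.isClosedEmbedding hinj).isEmbedding, ?_, ?_, ?_⟩ <;>
    rintro _ ⟨z, rfl⟩ <;> refine Metric.mem_closure_iff.2 fun ε hε => ?_ <;>
    obtain ⟨n, hn⟩ := hnear z hε
  · exact ⟨_, (node (PiNat.res z n)).2.1, hn _ (hcenter _)⟩
  · obtain ⟨u, hu, v, hv, huv⟩ := hboth z n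
    by_cases huA : u ∈ A
    · exact ⟨u, ⟨hu.1, huA⟩, hn u hu.2⟩
    · exact ⟨v, ⟨hv.1, by tauto⟩, hn v hv.2⟩
  · obtain ⟨u, hu, v, hv, huv⟩ := hboth z n
    by_cases huA : u ∈ A
    · exact ⟨v, ⟨hv.1, by tauto⟩, hn v hv.2⟩
    · exact ⟨u, ⟨hu.1, huA⟩, hn u hu.2⟩

end Metric

theorem not_mem_contIdeal_of_embedding {X : Type*} [TopologicalSpace X] {f : X → (ℕ → ℕ)}
    {K : Set X} {U : Set (ℕ → ℕ)} (hU : IsOpen U) {Y : Type*} [TopologicalSpace Y] [BaireSpace Y]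
    [Nonempty Y] {c : Y → X} (hc : Topology.IsEmbedding c) (hcK : range c ⊆ K)
    (hd : range c ⊆ closure (range c ∩ f ⁻¹' U))
    (hd' : range c ⊆ closure (range c \ f ⁻¹' U)) : K ∉ contIdeal f := by
  rintro ⟨C, hC, hKC⟩
  have dense {T : Set X} (hT : range c ⊆ closure (range c ∩ T)) : Dense (c ⁻¹' T) := fun y => by
    rw [hc.isInducing.closure_eq_preimage_closure_image, image_preimage_eq_range_inter]
    exact hT (mem_range_self y)
  obtain ⟨n, hn⟩ := nonempty_interior_of_iUnion_of_closed
    (fun n => (hC n).1.preimage hc.continuous) (by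
      rw [← preimage_iUnion, preimage_eq_univ_iff]
      exact hcK.trans hKC)
  have hcont : ContinuousOn (f ∘ c) (interior (c ⁻¹' C n)) :=
    (hC n).2.comp hc.continuous.continuousOn interior_subset
  have hopen := hcont.isOpen_inter_preimage isOpen_interior hU
  have hne := (dense hd).inter_open_nonempty _ isOpen_interior hn
  obtain ⟨y, ⟨-, hy⟩, hy'⟩ := (dense (T := (f ⁻¹' U)ᶜ) hd').inter_open_nonempty _ hopen hne
  exact hy' hy

theorem closed_positive_iff_cantor_witness
    {X : Type*} [TopologicalSpace X] [PolishSpace X]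
    (f : X → (ℕ → ℕ)) (hf : BaireClassOne f)
    (K : Set X) (hK : IsClosed K) :
    K ∉ contIdeal f ↔
      ∃ (U : Set (ℕ → ℕ)) (c : (ℕ → Bool) → X), IsOpen U ∧
        Topology.IsEmbedding c ∧ Set.range c ⊆ K ∧
        Set.range c ⊆ closure (Set.range c ∩ f ⁻¹' U) ∧
        Set.range c ⊆ closure (Set.range c \ f ⁻¹' U) := by
  constructor
  · intro hpos
    let := TopologicalSpace.upgradeIsCompletelyMetrizable X
    obtain ⟨U, D, hU, hD, hDK, hd, hd'⟩ := exists_isOpen_dense_codense_preimage hf hK hpos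
    obtain ⟨c, hc, hcD, h, h'⟩ := exists_embedding_cantor_dense_codense hD hd hd'
    exact ⟨U, c, hU, hc, hcD.trans (closure_minimal hDK hK), h, h'⟩
  · rintro ⟨U, c, hU, hc, hcK, hd, hd'⟩
    exact not_mem_contIdeal_of_embedding hU hc hcK hd hd'
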